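/- Fix n ≥ 1 and define the Sato coefficients b_{n−k} (k = 2,…,n+1) in the free ℝ-module on descents by the recursion b_{n−2} := −C(n,1) • 𝔭₁ and b_{n−k} := −C(n, k−1) • 𝔭_{k−1} − Σ_{ℓ=2}^{k−1} C(n−ℓ, k−1−ℓ) • (b_{n−ℓ} ⋆ 𝔭_{k−1−ℓ}), and write b_{−1} for the case k = n+1. Then b_{−1} = −Σ_{D ⊆ {1,…,n−1}} (−1)^{|D|} • (n, D), the sum over all descents of grade n. -/

import Mathlib

inductive PTree : Type
  | leaf : PTree
  | node : PTree → PTree → PTree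
  deriving DecidableEq

namespace PTree

/-- The grade of a planar binary rooted tree: its number of binary (internal) nodes. -/
def grade : PTree → ℕ
  | leaf => 0
  | node t1 t2 => grade t1 + grade t2 + 1

/-- The weight character of a planar binary rooted tree. -/
def alpha : PTree → ℕ
  | leaf => 1
  | node t1 t2 => Nat.choose (grade t1 + grade t2) (grade t1) * alpha t1 * alpha t2

end PTree

/-- The (finite) set of all planar binary rooted trees of a given grade. -/
def treesOfGrade : ℕ → Finset PTree
  | 0 => {PTree.leaf}
  | n + 1 =>
    (Finset.range (n + 1)).attach.biUnion fun j =>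
      (treesOfGrade j.1 ×ˢ treesOfGrade (n - j.1)).image fun p => PTree.node p.1 p.2
termination_by n => n
decreasing_by
  · exact Finset.mem_range.mp j.2
  · exact Nat.lt_succ_of_le (Nat.sub_le n j.1)

/-- A descent: a grade `n` together with a subset of `{1, …, n-1}`. -/
structure Descent : Type where
  grade : ℕ
  dset : Finset ℕ
  valid : dset ⊆ Finset.Icc 1 (grade - 1)

instance : DecidableEq Descent := fun a b =>
  decidable_of_iff (a.grade = b.grade ∧ a.dset = b.dset) (by
    constructor
    · rintro ⟨h1, h2⟩
      obtain ⟨g1, s1, v1⟩ := a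
      obtain ⟨g2, s2, v2⟩ := b
      dsimp at h1 h2
      subst h1; subst h2; rfl
    · rintro rfl; exact ⟨rfl, rfl⟩)

/-- The empty descent `∅₀` of grade `0`. -/
def emptyDescent : Descent := ⟨0, ∅, by simp⟩

/-- The grafting product of two descents. -/
def dstar (a b : Descent) : Descent where
  grade := a.grade + b.grade + 1
  dset := a.dset ∪ b.dset.image (fun e => e + a.grade + 1) ∪
    (if 1 ≤ a.grade then {a.grade} else ∅)
  valid := by
    intro x hx
    simp only [Finset.mem_union, Finset.mem_image] at hx
    simp only [Finset.mem_Icc]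
    rcases hx with (hx | hx) | hx
    · have h := Finset.mem_Icc.mp (a.valid hx); omega
    · obtain ⟨e, he, rfl⟩ := hx
      have h := Finset.mem_Icc.mp (b.valid he); omega
    · split_ifs at hx with h
      · rw [Finset.mem_singleton] at hx; omega
      · simp at hx

/-- The descent of a planar binary rooted tree. -/
def desc : PTree → Descent
  | .leaf => emptyDescent
  | .node t1 t2 => dstar (desc t1) (desc t2)

/-- The weight of a descent: the sum of the weight characters `α(τ)` over all (finitely many)
planar binary rooted trees `τ` with `desc τ = d`. -/
noncomputable def omegaD (d : Descent) : ℕ :=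
  ∑ᶠ (τ : PTree) (_ : desc τ = d), PTree.alpha τ

/-- The (finite) set of all descents of a given grade. -/
def descentsOfGrade (n : ℕ) : Finset Descent :=
  (Finset.Icc 1 (n - 1)).powerset.attach.image fun D =>
    ⟨n, D.1, Finset.mem_powerset.mp D.2⟩

/-- The bilinear extension of the grafting product to the free `ℝ`-module on descents. -/
noncomputable def graft2 (x y : Descent →₀ ℝ) : Descent →₀ ℝ :=
  x.sum fun d1 c1 => y.sum fun d2 c2 => Finsupp.single (dstar d1 d2) (c1 * c2)

/-- `𝔭_j`, the weighted sum of all descents of grade `j`, in the free `ℝ`-module on descents. -/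
noncomputable def pD (j : ℕ) : Descent →₀ ℝ :=
  ∑ d ∈ descentsOfGrade j, Finsupp.single d (omegaD d : ℝ)

/-- The Sato coefficients `b_{n-k}` (indexed by `k`), defined recursively. -/
noncomputable def satoB (n : ℕ) : ℕ → (Descent →₀ ℝ)
  | k =>
    -((n.choose (k - 1) : ℝ) • pD (k - 1)) -
      ∑ ℓ ∈ (Finset.Icc 2 (k - 1)).attach,
        (((n - ℓ.1).choose (k - 1 - ℓ.1) : ℝ)) • graft2 (satoB n ℓ.1) (pD (k - 1 - ℓ.1))
termination_by k => k
decreasing_by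
  have h := Finset.mem_Icc.mp ℓ.2
  omega

/-- Left-to-right grafting product of a list of elements of the free module on descents. -/
noncomputable def graftFoldl : List (Descent →₀ ℝ) → (Descent →₀ ℝ)
  | [] => 0
  | h :: t => t.foldl graft2 h

/-- `γ_n(c) = ∏ᵢ C(n − c₁ − ⋯ − c_{i−1}, cᵢ − 1)` for a composition `c`. -/
def gammaN (n : ℕ) {k : ℕ} (c : Composition k) : ℕ :=
  ∏ i ∈ Finset.range c.length,
    Nat.choose (n - (c.blocks.take i).sum) (c.blocks.getD i 0 - 1)

/-- The coefficient `∏ᵢ C(n − ‖𝔡₀‖ − ⋯ − ‖𝔡_{i−1}‖ − i, ‖𝔡ᵢ‖)` attached to a tuple of descents. -/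
def satoCoef (n : ℕ) (M : List Descent) : ℕ :=
  ∏ i ∈ Finset.range M.length,
    Nat.choose (n - ((M.take i).map Descent.grade).sum - i) ((M.getD i emptyDescent).grade)

/-- `s_n(𝔡)`: the alternating sum, over all left-nested factorizations of `𝔡` whose first
factor is not `∅₀`, of the Sato coefficient times the product of the descent weights. -/
noncomputable def sN (n : ℕ) (d : Descent) : ℤ :=
  ∑ᶠ (m : ℕ), (-1 : ℤ) ^ m *
    ∑ᶠ (p : Descent × List Descent)
      (_ : p.2.length = m ∧ p.1 ≠ emptyDescent ∧ p.2.foldl dstar p.1 = d),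
      ((satoCoef n (p.1 :: p.2) * ((p.1 :: p.2).map omegaD).prod : ℕ) : ℤ)

/-- The descent of grade `N` cut out by a Boolean predicate. -/
def mkD (N : ℕ) (P : ℕ → Bool) : Descent :=
  ⟨N, (Finset.Icc 1 (N - 1)).filter (fun x => P x = true), Finset.filter_subset _ _⟩

theorem Descent.ext' {a b : Descent} (h1 : a.grade = b.grade) (h2 : a.dset = b.dset) : a = b := by
  obtain ⟨g1, s1, v1⟩ := a
  obtain ⟨g2, s2, v2⟩ := b
  dsimp at h1 h2
  subst h1; subst h2; rfl

theorem mkD_congr {N : ℕ} {P Q : ℕ → Bool} (h : ∀ x, 1 ≤ x → x < N → P x = Q x) :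
    mkD N P = mkD N Q := by
  refine Descent.ext' (by rfl) ?_
  ext x
  simp only [mkD, Finset.mem_filter, Finset.mem_Icc]
  constructor
  · rintro ⟨⟨h1, h2⟩, h3⟩
    exact ⟨⟨h1, h2⟩, by rw [← h x h1 (by omega)]; exact h3⟩
  · rintro ⟨⟨h1, h2⟩, h3⟩
    exact ⟨⟨h1, h2⟩, by rw [h x h1 (by omega)]; exact h3⟩

theorem eq_mkD (d : Descent) : d = mkD d.grade (fun x => decide (x ∈ d.dset)) := by
  refine Descent.ext' (by rfl) ?_
  ext x
  simp only [mkD, Finset.mem_filter, decide_eq_true_eq]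
  exact ⟨fun h => ⟨d.valid h, h⟩, fun h => h.2⟩

theorem mem_mkD {N : ℕ} {P : ℕ → Bool} {x : ℕ} :
    x ∈ (mkD N P).dset ↔ 1 ≤ x ∧ x < N ∧ P x = true := by
  simp only [mkD, Finset.mem_filter, Finset.mem_Icc]
  constructor
  · rintro ⟨⟨h1, h2⟩, h3⟩; exact ⟨h1, by omega, h3⟩
  · rintro ⟨h1, h2, h3⟩; exact ⟨⟨h1, by omega⟩, h3⟩

theorem mem_dstar {a b : Descent} {x : ℕ} : x ∈ (dstar a b).dset ↔
    x ∈ a.dset ∨ (∃ e ∈ b.dset, e + a.grade + 1 = x) ∨ (1 ≤ a.grade ∧ x = a.grade) := by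
  simp only [dstar, Finset.mem_union, Finset.mem_image]
  split_ifs with h <;> simp [h, or_assoc]

theorem dstar_mkD (i j N : ℕ) (A B P : ℕ → Bool) :
    dstar (mkD i A) (mkD j B) = mkD N P ↔
      (i + j + 1 = N ∧ (i = 0 ∨ P i = true) ∧ (j = 0 ∨ P (i + 1) = false)) ∧
        mkD i A = mkD i P ∧ mkD j B = mkD j (fun e => P (e + i + 1)) := by
  have key : dstar (mkD i A) (mkD j B) = mkD N P ↔ i + j + 1 = N ∧ ∀ x,
      ((1 ≤ x ∧ x < i ∧ A x = true) ∨ (∃ e, (1 ≤ e ∧ e < j ∧ B e = true) ∧ e + i + 1 = x) ∨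
        (1 ≤ i ∧ x = i)) ↔ (1 ≤ x ∧ x < N ∧ P x = true) := by
    constructor
    · intro h
      refine ⟨congrArg Descent.grade h, fun x => ?_⟩
      have h2 : x ∈ (dstar (mkD i A) (mkD j B)).dset ↔ x ∈ (mkD N P).dset := by rw [h]
      simp only [mem_dstar, mem_mkD] at h2
      exact h2
    · rintro ⟨h1, h2⟩
      refine Descent.ext' h1 ?_
      ext x
      simp only [mem_dstar, mem_mkD]
      exact h2 x
  rw [key]
  constructor
  · rintro ⟨rfl, h⟩
    refine ⟨⟨rfl, ?_, ?_⟩, ?_, ?_⟩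
    · rcases Nat.eq_zero_or_pos i with h0 | h0
      · exact Or.inl h0
      · exact Or.inr ((h i).1 (Or.inr (Or.inr ⟨h0, rfl⟩))).2.2
    · rcases Nat.eq_zero_or_pos j with h0 | h0
      · exact Or.inl h0
      · right
        by_contra hc
        have hc' : P (i + 1) = true := by simpa using hc
        rcases (h (i + 1)).2 ⟨by omega, by omega, hc'⟩ with h1 | ⟨e, h1, h2⟩ | h1 <;> omega
    · apply mkD_congr
      intro x h1 h2
      have := h x
      rw [Bool.eq_iff_iff]
      constructor
      · intro hA; exact ((h x).1 (Or.inl ⟨h1, h2, hA⟩)).2.2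
      · intro hP
        rcases (h x).2 ⟨h1, by omega, hP⟩ with h3 | ⟨e, h3, h4⟩ | h3
        · exact h3.2.2
        · omega
        · omega
    · apply mkD_congr
      intro x h1 h2
      rw [Bool.eq_iff_iff]
      constructor
      · intro hA; exact ((h (x + i + 1)).1 (Or.inr (Or.inl ⟨x, ⟨h1, h2, hA⟩, rfl⟩))).2.2
      · intro hP
        rcases (h (x + i + 1)).2 ⟨by omega, by omega, hP⟩ with h3 | ⟨e, h3, h4⟩ | h3
        · omega
        · have : e = x := by omega
          subst this; exact h3.2.2
        · omega
  · rintro ⟨⟨rfl, h1, h2⟩, h3, h4⟩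
    refine ⟨rfl, fun x => ?_⟩
    have h3' : ∀ x, 1 ≤ x → x < i → A x = P x := by
      intro x hx1 hx2
      have : x ∈ (mkD i A).dset ↔ x ∈ (mkD i P).dset := by rw [h3]
      rw [mem_mkD, mem_mkD] at this
      rw [Bool.eq_iff_iff]
      tauto
    have h4' : ∀ x, 1 ≤ x → x < j → B x = P (x + i + 1) := by
      intro x hx1 hx2
      have : x ∈ (mkD j B).dset ↔ x ∈ (mkD j (fun e => P (e + i + 1))).dset := by rw [h4]
      rw [mem_mkD, mem_mkD] at this
      rw [Bool.eq_iff_iff]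
      tauto
    constructor
    · rintro (⟨a1, a2, a3⟩ | ⟨e, ⟨a1, a2, a3⟩, rfl⟩ | ⟨a1, rfl⟩)
      · exact ⟨a1, by omega, by rw [← h3' x a1 a2]; exact a3⟩
      · exact ⟨by omega, by omega, by rw [← h4' e a1 a2]; exact a3⟩
      · refine ⟨a1, by omega, ?_⟩
        rcases h1 with h1 | h1
        · omega
        · exact h1
    · rintro ⟨a1, a2, a3⟩
      rcases lt_trichotomy x i with hx | hx | hx
      · exact Or.inl ⟨a1, hx, by rw [h3' x a1 hx]; exact a3⟩
      · exact Or.inr (Or.inr ⟨by omega, hx⟩)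
      · right; left
        have hne : x ≠ i + 1 := by
          rintro rfl
          rcases h2 with h2 | h2
          · omega
          · rw [h2] at a3; exact absurd a3 (by decide)
        refine ⟨x - i - 1, ⟨by omega, by omega, ?_⟩, by omega⟩
        rw [h4' _ (by omega) (by omega)]
        rw [show x - i - 1 + i + 1 = x by omega]; exact a3

theorem dstar_eq_mkD (a b : Descent) (N : ℕ) (P : ℕ → Bool) :
    dstar a b = mkD N P ↔
      (a.grade + b.grade + 1 = N ∧ (a.grade = 0 ∨ P a.grade = true) ∧
        (b.grade = 0 ∨ P (a.grade + 1) = false)) ∧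
        a = mkD a.grade P ∧ b = mkD b.grade (fun e => P (e + a.grade + 1)) := by
  have := dstar_mkD a.grade b.grade N (fun x => decide (x ∈ a.dset))
    (fun x => decide (x ∈ b.dset)) P
  rw [← eq_mkD a, ← eq_mkD b] at this
  exact this

theorem desc_grade (t : PTree) : (desc t).grade = t.grade := by
  induction t with
  | leaf => rfl
  | node a b ha hb => simp only [desc, dstar, PTree.grade, ha, hb]

theorem treesOfGrade_succ (n : ℕ) : treesOfGrade (n + 1) =
    (Finset.range (n + 1)).biUnion fun j =>
      (treesOfGrade j ×ˢ treesOfGrade (n - j)).image fun p => PTree.node p.1 p.2 := by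
  rw [treesOfGrade]
  ext t
  simp

theorem mem_treesOfGrade (t : PTree) : ∀ n, t ∈ treesOfGrade n ↔ t.grade = n := by
  induction t with
  | leaf =>
    intro n
    cases n with
    | zero => simp [treesOfGrade, PTree.grade]
    | succ n => rw [treesOfGrade_succ]; simp [PTree.grade]
  | node a b ha hb =>
    intro n
    cases n with
    | zero => simp [treesOfGrade, PTree.grade]
    | succ n =>
      rw [treesOfGrade_succ]
      simp only [Finset.mem_biUnion, Finset.mem_range, Finset.mem_image, Finset.mem_product,
        PTree.node.injEq, Prod.exists, PTree.grade]
      constructor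
      · rintro ⟨j, hj, x, y, ⟨h1, h2⟩, rfl, rfl⟩
        rw [ha] at h1; rw [hb] at h2
        omega
      · intro h
        exact ⟨a.grade, by omega, a, b, ⟨(ha _).2 rfl, (hb _).2 (by omega)⟩, rfl, rfl⟩

theorem sum_treesOfGrade_succ (n : ℕ) (F : PTree → ℕ) :
    ∑ t ∈ treesOfGrade (n + 1), F t = ∑ j ∈ Finset.range (n + 1),
      ∑ a ∈ treesOfGrade j, ∑ b ∈ treesOfGrade (n - j), F (PTree.node a b) := by
  rw [treesOfGrade_succ, Finset.sum_biUnion]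
  · refine Finset.sum_congr rfl fun j _ => ?_
    rw [Finset.sum_image, Finset.sum_product]
    rintro ⟨a, b⟩ _ ⟨c, d⟩ _ h
    simpa using h
  · intro i _ j _ hij
    simp only [Function.onFun]
    rw [Finset.disjoint_left]
    intro t h1 h2
    simp only [Finset.mem_image, Finset.mem_product, Prod.exists, mem_treesOfGrade] at h1 h2
    obtain ⟨a, b, ⟨h3, h4⟩, rfl⟩ := h1
    obtain ⟨c, d, ⟨h5, h6⟩, h7⟩ := h2
    injection h7 with h8 h9
    subst h8
    omega

theorem omegaD_eq (d : Descent) (N : ℕ) (h : d.grade = N) :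
    omegaD d = ∑ t ∈ treesOfGrade N, if desc t = d then t.alpha else 0 := by
  unfold omegaD
  rw [← Finset.sum_filter]
  rw [← finsum_mem_coe_finset]
  apply finsum_congr
  intro t
  by_cases ht : desc t = d
  · have : t ∈ treesOfGrade N := by rw [mem_treesOfGrade, ← desc_grade, ht, h]
    simp [ht, this]
  · simp [ht]

/-- The weight of the descent cut out by a predicate. -/
noncomputable def wD (N : ℕ) (P : ℕ → Bool) : ℕ := omegaD (mkD N P)

theorem wD_congr {N : ℕ} {P Q : ℕ → Bool} (h : ∀ x, 1 ≤ x → x < N → P x = Q x) :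
    wD N P = wD N Q := by
  unfold wD; rw [mkD_congr h]

theorem wD_zero (P : ℕ → Bool) : wD 0 P = 1 := by
  unfold wD
  rw [omegaD_eq _ 0 rfl]
  have : desc PTree.leaf = mkD 0 P := by
    refine Descent.ext' (by rfl) ?_
    ext x
    rw [mem_mkD]
    simp [desc, emptyDescent]
  simp [treesOfGrade, this, PTree.alpha]

theorem wD_succ (n : ℕ) (P : ℕ → Bool) : wD (n + 1) P = ∑ i ∈ Finset.range (n + 1),
    if (i = 0 ∨ P i = true) ∧ (i = n ∨ P (i + 1) = false) then
      n.choose i * wD i P * wD (n - i) (fun e => P (e + i + 1)) else 0 := by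
  unfold wD
  rw [omegaD_eq _ (n + 1) rfl, sum_treesOfGrade_succ]
  refine Finset.sum_congr rfl fun i hi => ?_
  have hi' : i ≤ n := by have := Finset.mem_range.1 hi; omega
  have e1 : ∀ a ∈ treesOfGrade i, ∀ b ∈ treesOfGrade (n - i),
      (if desc (PTree.node a b) = mkD (n + 1) P then (PTree.node a b).alpha else 0) =
      if (i = 0 ∨ P i = true) ∧ (i = n ∨ P (i + 1) = false) then
        n.choose i * (if desc a = mkD i P then a.alpha else 0) *
          (if desc b = mkD (n - i) (fun e => P (e + i + 1)) then b.alpha else 0) else 0 := by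
    intro a ha b hb
    rw [mem_treesOfGrade] at ha hb
    have hd : desc (PTree.node a b) = mkD (n + 1) P ↔
        ((i = 0 ∨ P i = true) ∧ (i = n ∨ P (i + 1) = false)) ∧ desc a = mkD i P ∧
          desc b = mkD (n - i) (fun e => P (e + i + 1)) := by
      rw [desc, dstar_eq_mkD, desc_grade, desc_grade, ha, hb]
      have q1 : i + (n - i) + 1 = n + 1 := by omega
      have q2 : n - i = 0 ↔ i = n := by omega
      rw [q2]
      simp only [q1, true_and]
    have hal : (PTree.node a b).alpha = n.choose i * a.alpha * b.alpha := by
      rw [PTree.alpha, ha, hb, show i + (n - i) = n by omega]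
    rw [hal]
    by_cases c1 : (i = 0 ∨ P i = true) ∧ (i = n ∨ P (i + 1) = false)
    · by_cases c2 : desc a = mkD i P
      · by_cases c3 : desc b = mkD (n - i) (fun e => P (e + i + 1))
        · rw [if_pos (hd.2 ⟨c1, c2, c3⟩), if_pos c1, if_pos c2, if_pos c3]
        · rw [if_neg (fun h => c3 (hd.1 h).2.2), if_pos c1, if_neg c3, mul_zero]
      · rw [if_neg (fun h => c2 (hd.1 h).2.1), if_pos c1, if_neg c2, mul_zero, zero_mul]
    · rw [if_neg (fun h => c1 (hd.1 h).1), if_neg c1]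
  rw [Finset.sum_congr rfl fun a ha => Finset.sum_congr rfl fun b hb => e1 a ha b hb]
  rw [omegaD_eq (mkD i P) i rfl, omegaD_eq (mkD (n - i) _) (n - i) rfl]
  split_ifs with c
  · rw [mul_assoc, Finset.sum_mul_sum, Finset.mul_sum]
    refine Finset.sum_congr rfl fun a _ => ?_
    rw [Finset.mul_sum]
    refine Finset.sum_congr rfl fun b _ => ?_
    rw [mul_assoc]
  · simp

theorem wD_false (N : ℕ) (P : ℕ → Bool) (h : ∀ x, 1 ≤ x → x < N → P x = false) :
    wD N P = 1 := by
  induction N generalizing P with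
  | zero => exact wD_zero P
  | succ n ih =>
    rw [wD_succ, Finset.sum_eq_single 0]
    · rw [if_pos, wD_zero, Nat.sub_zero, ih]
      · simp
      · intro x h1 h2; exact h _ (by omega) (by omega)
      · refine ⟨Or.inl rfl, ?_⟩
        by_cases hn : n = 0
        · exact Or.inl hn.symm
        · exact Or.inr (h _ (by omega) (by omega))
    · intro i hi h0
      have := Finset.mem_range.1 hi
      rw [if_neg]
      rintro ⟨h1 | h1, -⟩
      · exact h0 h1
      · rw [h i (by omega) (by omega)] at h1; exact absurd h1 (by decide)
    · intro h; simp at h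

/-- Adding and removing the largest descent. -/
theorem wD_add (N j : ℕ) (P Q : ℕ → Bool) (hj : 1 ≤ j) (hjN : j < N)
    (hP : P j = true) (hQ : Q j = false) (hPQ : ∀ x, 1 ≤ x → x < j → P x = Q x)
    (hP' : ∀ x, j < x → x < N → P x = false) (hQ' : ∀ x, j < x → x < N → Q x = false) :
    wD N P + wD N Q = N.choose j * wD j P := by
  induction N using Nat.strong_induction_on generalizing j P Q with
  | _ N ih =>
    obtain ⟨n, rfl⟩ : ∃ n, N = n + 1 := ⟨N - 1, by omega⟩
    obtain ⟨k, rfl⟩ : ∃ k, j = k + 1 := ⟨j - 1, by omega⟩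
    rw [wD_succ n P, wD_succ n Q, ← Finset.sum_add_distrib]
    obtain ⟨r, rfl⟩ : ∃ r, n = k + 1 + r := ⟨n - (k + 1), by omega⟩
    rw [show k + 1 + r + 1 = (k + 1) + (r + 1) by omega, Finset.sum_range_add,
      Finset.sum_range_succ' _ r]
    have z : ∀ x ∈ Finset.range r, ((if (k + 1 + (x + 1) = 0 ∨ P (k + 1 + (x + 1)) = true) ∧
        (k + 1 + (x + 1) = k + 1 + r ∨ P (k + 1 + (x + 1) + 1) = false) then
        (k + 1 + r).choose (k + 1 + (x + 1)) * wD (k + 1 + (x + 1)) P *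
          wD (k + 1 + r - (k + 1 + (x + 1))) (fun e => P (e + (k + 1 + (x + 1)) + 1)) else 0) +
        (if (k + 1 + (x + 1) = 0 ∨ Q (k + 1 + (x + 1)) = true) ∧
        (k + 1 + (x + 1) = k + 1 + r ∨ Q (k + 1 + (x + 1) + 1) = false) then
        (k + 1 + r).choose (k + 1 + (x + 1)) * wD (k + 1 + (x + 1)) Q *
          wD (k + 1 + r - (k + 1 + (x + 1))) (fun e => Q (e + (k + 1 + (x + 1)) + 1)) else 0)) = 0 := by
      intro x hx
      have hx := Finset.mem_range.1 hx
      rw [hP' (k + 1 + (x + 1)) (by omega) (by omega), hQ' (k + 1 + (x + 1)) (by omega) (by omega)]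
      simp
    rw [Finset.sum_eq_zero z, zero_add, Nat.add_zero, hQ]
    have c1 : (k + 1 = 0 ∨ P (k + 1) = true) ∧ (k + 1 = k + 1 + r ∨ P (k + 1 + 1) = false) := by
      refine ⟨Or.inr hP, ?_⟩
      by_cases hr : r = 0
      · left; omega
      · right; exact hP' _ (by omega) (by omega)
    have c2 : ¬ ((k + 1 = 0 ∨ false = true) ∧ (k + 1 = k + 1 + r ∨ Q (k + 1 + 1) = false)) := by
      simp
    rw [if_pos c1, if_neg c2, wD_false (k + 1 + r - (k + 1)), add_zero, mul_one,
      show k + 1 + (r + 1) = k + 1 + r + 1 by omega, Nat.choose_succ_succ, add_mul]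
    swap
    · intro x h1 h2; exact hP' _ (by omega) (by omega)
    congr 1
    rw [wD_succ k P, Finset.mul_sum]
    refine Finset.sum_congr rfl fun i hi => ?_
    have hi := Finset.mem_range.1 hi
    have hch : (k + 1 + r).choose k * k.choose i =
        (k + 1 + r).choose i * (k + 1 + r - i).choose (k - i) :=
      Nat.choose_mul (by omega)
    rcases Nat.lt_or_ge i k with hik | hik
    · -- both terms are present
      have hiP : (i = 0 ∨ Q i = true) ↔ (i = 0 ∨ P i = true) := by
        by_cases h0 : i = 0
        · simp [h0]
        · rw [hPQ i (by omega) (by omega)]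
      simp only [hiP, ← hPQ (i + 1) (by omega) (by omega)]
      have e1 : i = k + 1 + r ↔ False := iff_false_intro (by omega)
      have e2 : i = k ↔ False := iff_false_intro (by omega)
      simp only [e1, e2]
      have hwQ : wD i Q = wD i P := wD_congr fun x h1 h2 => (hPQ x h1 (by omega)).symm
      rw [hwQ]
      have hrec := ih (k + 1 + r - i) (by omega) (k - i) (fun e => P (e + i + 1))
        (fun e => Q (e + i + 1)) (by omega) (by omega)
        (by rw [← hP]; congr 1; omega) (by rw [← hQ]; congr 1; omega)
        (fun x h1 h2 => hPQ _ (by omega) (by omega))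
        (fun x h1 h2 => hP' _ (by omega) (by omega))
        (fun x h1 h2 => hQ' _ (by omega) (by omega))
      split_ifs with c
      · rw [← mul_add, hrec]
        calc _ = ((k + 1 + r).choose i * (k + 1 + r - i).choose (k - i)) *
              (wD i P * wD (k - i) fun e => P (e + i + 1)) := by ring
          _ = _ := by rw [← hch]; ring
      · simp
    · have : i = k := by omega
      subst this
      have c3 : ¬ ((i = 0 ∨ P i = true) ∧ (i = i + 1 + r ∨ P (i + 1) = false)) := by
        rw [hP]; rintro ⟨-, h | h⟩
        · omega
        · exact absurd h (by decide)
      rw [if_neg c3, zero_add, hQ]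
      have hwQ : wD i Q = wD i P := wD_congr fun x h1 h2 => (hPQ x h1 (by omega)).symm
      have hiP : (i = 0 ∨ Q i = true) ↔ (i = 0 ∨ P i = true) := by
        by_cases h0 : i = 0
        · simp [h0]
        · rw [hPQ i (by omega) (by omega)]
      simp only [hiP]
      rw [hwQ, wD_false (i + 1 + r - i), Nat.sub_self, wD_zero]
      · simp
      · intro x h1 h2; exact hQ' _ (by omega) (by omega)

/-- The sign attached to the descents in `[a, N)`. -/
def sg (P : ℕ → Bool) (a N : ℕ) : ℝ := ∏ x ∈ Finset.Ico a N, if P x = true then (-1 : ℝ) else 1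

theorem wD_trunc (N : ℕ) (P : ℕ → Bool) (K : ℕ) (hK : 1 ≤ K) (hKN : K ≤ N) :
    (wD N (fun x => P x && decide (x < K)) : ℝ) +
      ∑ m ∈ Finset.Ico 1 K, (if P m = true then (N.choose m : ℝ) * wD m P * sg P m K else 0) =
      sg P 1 K := by
  induction K, hK using Nat.le_induction with
  | base =>
    rw [wD_false]
    · simp [sg]
    · intro x h1 h2
      have : ¬ x < 1 := by omega
      simp [this]
  | succ K hK ih =>
    have ih := ih (by omega)
    have hs : ∀ m, m ≤ K → sg P m (K + 1) = sg P m K * (if P K = true then (-1 : ℝ) else 1) := by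
      intro m hm
      unfold sg
      rw [Finset.prod_Ico_succ_top hm]
    rw [Finset.sum_Ico_succ_top hK, hs 1 hK, ← ih, hs K le_rfl]
    have hsum : ∑ m ∈ Finset.Ico 1 K,
        (if P m = true then (N.choose m : ℝ) * wD m P * sg P m (K + 1) else 0) =
        (∑ m ∈ Finset.Ico 1 K, (if P m = true then (N.choose m : ℝ) * wD m P * sg P m K else 0)) *
          (if P K = true then (-1 : ℝ) else 1) := by
      rw [Finset.sum_mul]
      refine Finset.sum_congr rfl fun m hm => ?_
      have := Finset.mem_Ico.1 hm
      rw [hs m (by omega), ite_mul, zero_mul]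
      congr 1
      ring
    rw [hsum]
    have hself : sg P K K = 1 := by simp [sg]
    rw [hself]
    by_cases hp : P K = true
    · have hadd := wD_add N K (fun x => P x && decide (x < K + 1)) (fun x => P x && decide (x < K))
        hK (by omega) (by simp [hp]) (by simp)
        (fun x h1 h2 => by
          have : x < K + 1 := by omega
          simp [h2, this])
        (fun x h1 h2 => by
          have : ¬ x < K + 1 := by omega
          simp [this])
        (fun x h1 h2 => by
          have : ¬ x < K := by omega
          simp [this])
      have hw : wD K (fun x => P x && decide (x < K + 1)) = wD K P :=
        wD_congr fun x h1 h2 => by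
          have : x < K + 1 := by omega
          simp [this]
      rw [hw] at hadd
      have hadd' : (wD N (fun x => P x && decide (x < K + 1)) : ℝ) +
        wD N (fun x => P x && decide (x < K)) = N.choose K * wD K P := by exact_mod_cast hadd
      simp only [hp, if_true]
      linarith
    · have hw : wD N (fun x => P x && decide (x < K + 1)) = wD N (fun x => P x && decide (x < K)) :=
        wD_congr fun x h1 h2 => by
          rcases lt_trichotomy x K with h | h | h
          · have : x < K + 1 := by omega
            simp [h, this]
          · subst h; simp [hp]
          · have h3 : ¬ x < K + 1 := by omega
            have h4 : ¬ x < K := by omega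
            simp [h3, h4]
      rw [hw]
      simp [hp]

/-- The key alternating identity. -/
theorem wD_alt (N : ℕ) (P : ℕ → Bool) :
    (wD N P : ℝ) +
      ∑ m ∈ Finset.Ico 1 N, (if P m = true then (N.choose m : ℝ) * wD m P * sg P m N else 0) =
      sg P 1 N := by
  rcases Nat.eq_zero_or_pos N with h | h
  · subst h; rw [wD_zero]; simp [sg]
  · rw [← wD_trunc N P N h le_rfl]
    congr 2
    exact wD_congr fun x h1 h2 => by simp [h2]

theorem mem_descentsOfGrade (d : Descent) (n : ℕ) : d ∈ descentsOfGrade n ↔ d.grade = n := by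
  unfold descentsOfGrade
  simp only [Finset.mem_image, Finset.mem_attach, true_and, Subtype.exists, Finset.mem_powerset]
  constructor
  · rintro ⟨D, hD, rfl⟩; rfl
  · rintro rfl
    exact ⟨d.dset, d.valid, rfl⟩

theorem pD_apply (j : ℕ) (d : Descent) : pD j d = if d.grade = j then (omegaD d : ℝ) else 0 := by
  unfold pD
  rw [Finsupp.finsetSum_apply]
  simp only [Finsupp.single_apply]
  rw [Finset.sum_ite_eq']
  simp only [mem_descentsOfGrade]

theorem pD_mkD (j : ℕ) (P : ℕ → Bool) : pD j (mkD j P) = wD j P := by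
  rw [pD_apply]
  exact if_pos rfl

theorem satoB_rec (n m : ℕ) : satoB n (m + 1) = -((n.choose m : ℝ) • pD m) -
    ∑ j ∈ Finset.Ico 1 m, ((n - (j + 1)).choose (m - (j + 1)) : ℝ) •
      graft2 (satoB n (j + 1)) (pD (m - (j + 1))) := by
  rw [satoB]
  simp only [Nat.add_sub_cancel]
  congr 1
  refine (Finset.sum_attach (Finset.Icc 2 m) (fun l => ((n - l).choose (m - l) : ℝ) •
      graft2 (satoB n l) (pD (m - l)))).trans ?_
  rw [Finset.sum_Ico_add' (fun l => ((n - l).choose (m - l) : ℝ) •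
      graft2 (satoB n l) (pD (m - l))) 1 m 1]
  refine Finset.sum_congr ?_ fun _ _ => rfl
  ext x
  simp only [Finset.mem_Icc, Finset.mem_Ico]
  omega

theorem graft2_apply (x y : Descent →₀ ℝ) (i j N : ℕ) (P : ℕ → Bool)
    (hx : ∀ d, x d ≠ 0 → d.grade = i) (hy : ∀ d, y d ≠ 0 → d.grade = j) :
    graft2 x y (mkD N P) =
      if i + j + 1 = N ∧ (i = 0 ∨ P i = true) ∧ (j = 0 ∨ P (i + 1) = false) then
        x (mkD i P) * y (mkD j (fun e => P (e + i + 1))) else 0 := by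
  unfold graft2
  simp only [Finsupp.sum, Finsupp.finsetSum_apply]
  have e1 : ∀ a ∈ x.support, ∀ b ∈ y.support,
      Finsupp.single (dstar a b) (x a * y b) (mkD N P) =
      if i + j + 1 = N ∧ (i = 0 ∨ P i = true) ∧ (j = 0 ∨ P (i + 1) = false) then
        (if a = mkD i P then x a else 0) *
          (if b = mkD j (fun e => P (e + i + 1)) then y b else 0) else 0 := by
    intro a ha b hb
    have ga := hx a (Finsupp.mem_support_iff.1 ha)
    have gb := hy b (Finsupp.mem_support_iff.1 hb)
    have hd := dstar_eq_mkD a b N P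
    rw [ga, gb] at hd
    rw [Finsupp.single_apply]
    by_cases c1 : i + j + 1 = N ∧ (i = 0 ∨ P i = true) ∧ (j = 0 ∨ P (i + 1) = false)
    · by_cases c2 : a = mkD i P
      · by_cases c3 : b = mkD j (fun e => P (e + i + 1))
        · rw [if_pos (hd.2 ⟨c1, c2, c3⟩), if_pos c1, if_pos c2, if_pos c3]
        · rw [if_neg (fun h => c3 (hd.1 h).2.2), if_pos c1, if_neg c3, mul_zero]
      · rw [if_neg (fun h => c2 (hd.1 h).2.1), if_pos c1, if_neg c2, zero_mul]
    · rw [if_neg (fun h => c1 (hd.1 h).1), if_neg c1]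
  rw [Finset.sum_congr rfl fun a ha => Finset.sum_congr rfl fun b hb => e1 a ha b hb]
  have ev : ∀ (z : Descent →₀ ℝ) (d : Descent),
      ∑ a ∈ z.support, (if a = d then z a else 0) = z d := by
    intro z d
    rw [Finset.sum_ite_eq']
    split_ifs with h
    · rfl
    · exact (Finsupp.notMem_support_iff.1 h).symm
  split_ifs with c
  · rw [← Finset.sum_mul_sum, ev, ev]
  · simp

theorem pD_hom (j : ℕ) (d : Descent) (h : pD j d ≠ 0) : d.grade = j := by
  by_contra hc
  rw [pD_apply, if_neg hc] at h
  exact h rfl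

theorem satoB_hom (n m : ℕ) : ∀ d, satoB n (m + 1) d ≠ 0 → d.grade = m := by
  induction m using Nat.strong_induction_on with
  | _ m ih =>
    intro d hd
    by_contra hc
    apply hd
    rw [satoB_rec, Finsupp.sub_apply, Finsupp.neg_apply, Finsupp.smul_apply, pD_apply, if_neg hc,
      Finsupp.finsetSum_apply, Finset.sum_eq_zero]
    · simp
    · intro j hj
      have hj := Finset.mem_Ico.1 hj
      rw [Finsupp.smul_apply, eq_mkD d, graft2_apply _ _ j (m - (j + 1)) _ _ (ih j hj.2) (pD_hom _),
        if_neg, smul_zero]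
      rintro ⟨h, -⟩
      omega

theorem sato_coef_rec (n m : ℕ) (P : ℕ → Bool) :
    (n.choose m : ℝ) * wD m P = -satoB n (m + 1) (mkD m P) +
      ∑ j ∈ Finset.Ico 1 m, (-satoB n (j + 1) (mkD j P)) *
        (if P j = true ∧ (m = j + 1 ∨ P (j + 1) = false) then
          ((n - (j + 1)).choose (m - (j + 1)) : ℝ) *
            wD (m - (j + 1)) (fun e => P (e + j + 1)) else 0) := by
  conv_rhs => rw [satoB_rec n m]
  rw [Finsupp.sub_apply, Finsupp.neg_apply, Finsupp.smul_apply, pD_mkD, Finsupp.finsetSum_apply]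
  have : ∑ j ∈ Finset.Ico 1 m, (((n - (j + 1)).choose (m - (j + 1)) : ℝ) •
      graft2 (satoB n (j + 1)) (pD (m - (j + 1)))) (mkD m P) =
      -∑ j ∈ Finset.Ico 1 m, (-satoB n (j + 1) (mkD j P)) *
        (if P j = true ∧ (m = j + 1 ∨ P (j + 1) = false) then
          ((n - (j + 1)).choose (m - (j + 1)) : ℝ) *
            wD (m - (j + 1)) (fun e => P (e + j + 1)) else 0) := by
    rw [← Finset.sum_neg_distrib]
    refine Finset.sum_congr rfl fun j hj => ?_
    have hj := Finset.mem_Ico.1 hj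
    rw [Finsupp.smul_apply, graft2_apply _ _ j (m - (j + 1)) _ _ (satoB_hom n j) (pD_hom _), pD_mkD]
    have q : (j + (m - (j + 1)) + 1 = m ∧ (j = 0 ∨ P j = true) ∧
        (m - (j + 1) = 0 ∨ P (j + 1) = false)) ↔
        (P j = true ∧ (m = j + 1 ∨ P (j + 1) = false)) := by
      have q1 : j + (m - (j + 1)) + 1 = m := by omega
      have q2 : j ≠ 0 := by omega
      have q3 : m - (j + 1) = 0 ↔ m = j + 1 := by omega
      rw [q3]
      simp [q1, q2]
    simp only [q]
    split_ifs
    · rw [smul_eq_mul]; ring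
    · simp
  rw [this, smul_eq_mul]
  ring

theorem sg_self (P : ℕ → Bool) (n : ℕ) : sg P n n = 1 := by simp [sg]

theorem sg_step (P : ℕ → Bool) (j n : ℕ) (h : j < n) :
    sg P j n = (if P j = true then (-1 : ℝ) else 1) * sg P (j + 1) n := by
  unfold sg
  rw [Finset.prod_eq_prod_Ico_succ_bot h]

theorem sg_shift (P : ℕ → Bool) (a N c : ℕ) :
    sg (fun e => P (e + c)) a N = sg P (a + c) (N + c) := by
  unfold sg
  rw [Finset.prod_Ico_add' (fun x => if P x = true then (-1 : ℝ) else 1) a N c]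

/-- The dual vector. -/
def gV (P : ℕ → Bool) (n m : ℕ) : ℝ := if m = n ∨ P m = true then sg P m n else 0

theorem alt_gV (N : ℕ) (hN : 1 ≤ N) (P : ℕ → Bool) :
    ∑ m ∈ Finset.Ico 1 (N + 1), gV P N m * ((N.choose m : ℝ) * wD m P) = sg P 1 N := by
  rw [← wD_alt N P, Finset.sum_Ico_succ_top hN, add_comm]
  congr 1
  · simp [gV, sg_self]
  · refine Finset.sum_congr rfl fun m hm => ?_
    have hm := Finset.mem_Ico.1 hm
    have : m ≠ N := by omega
    simp only [gV, this, false_or]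
    split_ifs
    · ring
    · simp

theorem dual_gV (n j : ℕ) (hj : 1 ≤ j) (hjn : j < n) (P : ℕ → Bool) :
    ∑ m ∈ Finset.Ico (j + 1) (n + 1), gV P n m *
      (if P j = true ∧ (m = j + 1 ∨ P (j + 1) = false) then
          ((n - (j + 1)).choose (m - (j + 1)) : ℝ) *
            wD (m - (j + 1)) (fun e => P (e + j + 1)) else 0) = - gV P n j := by
  have hjne : j ≠ n := by omega
  by_cases hp : P j = true
  swap
  · simp [hp, gV, hjne]
  have hgj : gV P n j = - sg P (j + 1) n := by
    simp only [gV, hp, or_true, if_true]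
    rw [sg_step P j n hjn]
    simp [hp]
  rw [hgj, neg_neg]
  by_cases hc : j + 1 = n ∨ P (j + 1) = true
  · rw [Finset.sum_eq_single (j + 1)]
    · simp [hp, wD_zero, gV, hc]
    · intro m hm hne
      have hm := Finset.mem_Ico.1 hm
      rcases hc with hc | hc
      · omega
      · simp [hne, hc]
    · intro h
      exact absurd (Finset.mem_Ico.2 ⟨le_rfl, by omega⟩) h
  · have hc1 : j + 1 ≠ n := fun h => hc (Or.inl h)
    have hc2 : P (j + 1) = false := by
      by_contra h
      exact hc (Or.inr (by simpa using h))
    obtain ⟨N, rfl⟩ : ∃ N, n = N + (j + 1) := ⟨n - (j + 1), by omega⟩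
    rw [Finset.sum_eq_sum_Ico_succ_bot (by omega)]
    have hz : gV P (N + (j + 1)) (j + 1) = 0 := by simp only [gV, if_neg hc]
    rw [hz, zero_mul, zero_add, sg_step P (j + 1) _ (by omega), hc2]
    have h1 := alt_gV N (by omega) (fun e => P (e + (j + 1)))
    rw [sg_shift] at h1
    rw [show j + 1 + 1 = 1 + (j + 1) by omega, ← h1,
      show N + (j + 1) + 1 = N + 1 + (j + 1) by omega, ← Finset.sum_Ico_add']
    simp only [Bool.false_eq_true, if_false, one_mul]
    refine Finset.sum_congr rfl fun m hm => ?_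
    rw [Nat.add_sub_cancel, Nat.add_sub_cancel, if_pos ⟨hp, Or.inr trivial⟩]
    congr 1
    simp only [gV, sg_shift, Nat.add_right_cancel_iff]

theorem sum_swap (n : ℕ) (F : ℕ → ℕ → ℝ) :
    ∑ m ∈ Finset.Ico 1 (n + 1), ∑ j ∈ Finset.Ico 1 m, F m j =
      ∑ j ∈ Finset.Ico 1 (n + 1), ∑ m ∈ Finset.Ico (j + 1) (n + 1), F m j := by
  apply Finset.sum_comm'
  intro x y
  simp only [Finset.mem_Ico]
  omega

theorem sato_coef (n : ℕ) (hn : 1 ≤ n) (P : ℕ → Bool) :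
    -satoB n (n + 1) (mkD n P) = sg P 1 n := by
  rw [← alt_gV n hn P]
  simp only [sato_coef_rec n _ P, mul_add, Finset.sum_add_distrib, Finset.mul_sum]
  rw [sum_swap]
  simp only [mul_left_comm (gV P n _), ← Finset.mul_sum]
  rw [Finset.sum_Ico_succ_top hn, Finset.sum_Ico_succ_top hn, Finset.Ico_self, Finset.sum_empty,
    mul_zero, add_zero]
  have : ∀ j ∈ Finset.Ico 1 n, (-satoB n (j + 1) (mkD j P)) *
      ∑ m ∈ Finset.Ico (j + 1) (n + 1), gV P n m *
    (if P j = true ∧ (m = j + 1 ∨ P (j + 1) = false) then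
        ((n - (j + 1)).choose (m - (j + 1)) : ℝ) *
          wD (m - (j + 1)) (fun e => P (e + j + 1)) else 0) =
      - (gV P n j * (-satoB n (j + 1) (mkD j P))) := by
    intro j hj
    have hj := Finset.mem_Ico.1 hj
    rw [dual_gV n j hj.1 hj.2]
    ring
  rw [Finset.sum_congr rfl this, Finset.sum_neg_distrib]
  have hg : gV P n n = 1 := by simp [gV, sg_self]
  rw [hg]
  ring

theorem sg_card (n : ℕ) (P : ℕ → Bool) : sg P 1 n = (-1 : ℝ) ^ (mkD n P).dset.card := by
  unfold sg mkD
  rw [Finset.prod_ite, Finset.prod_const, Finset.prod_const_one, mul_one]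
  rfl

/-- The collapsed form of the `n`-th Sato coefficient `b_{−1}` (the case `k = n+1`):
`b_{−1} = −Σ_{D ⊆ {1,…,n−1}} (−1)^{|D|} • (n, D)`, the sum over all descents of grade `n`. -/
theorem sato_b_neg_one (n : ℕ) (hn : 1 ≤ n) :
    satoB n (n + 1) =
      -∑ d ∈ descentsOfGrade n, ((-1 : ℝ) ^ d.dset.card) • Finsupp.single d (1 : ℝ) := by
  ext d
  rw [Finsupp.neg_apply, Finsupp.finsetSum_apply]
  simp only [Finsupp.smul_apply, Finsupp.single_apply, smul_eq_mul, mul_ite, mul_one, mul_zero]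
  rw [Finset.sum_ite_eq']
  simp only [mem_descentsOfGrade]
  split_ifs with h
  · have h1 := sato_coef n hn (fun x => decide (x ∈ d.dset))
    rw [sg_card] at h1
    have h2 := eq_mkD d
    rw [h] at h2
    rw [← h2] at h1
    rw [← h1, neg_neg]
  · rw [neg_zero]
    by_contra hc
    exact h (satoB_hom n n d hc)
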